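/- Fix α > 0, 1 ≤ p ≤ ∞, and set γ_α(y) = |y|^{−α} for y ≠ 0. Let Ω be a bounded open set in ℝ^N whose closure does not contain the origin. Then there exists r_Ω > 0 such that for all 0 < r < r_Ω: if p > (α+N)/(α+1), then γ_α(x) ≤ ν_p^r[γ_α](x) for every x in the closure of Ω (so γ_α is variationally p-subharmonious in Ω); and if p < (α+N)/(α+1), then γ_α(x) ≥ ν_p^r[γ_α](x) for every x in the closure of Ω (so γ_α is variationally p-superharmonious in Ω). -/

import Mathlib

open MeasureTheory Filter Topology Metric
open scoped ENNReal

noncomputable section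

/-- The variational `p`-mean predicate: `m` minimizes the (normalized) `L^p` distance of `v`
to constants, with respect to the measure `μ`. -/
def IsPMean {N : ℕ} (p : ℝ≥0∞) (μ : Measure (EuclideanSpace ℝ (Fin N)))
    (v : EuclideanSpace ℝ (Fin N) → ℝ) (m : ℝ) : Prop :=
  ∀ ν : ℝ, eLpNorm (fun x => v x - m) p μ ≤ eLpNorm (fun x => v x - ν) p μ

/-- The `p`-mean of `v` with respect to `μ` (chosen among the minimizers). -/
def pMean {N : ℕ} (p : ℝ≥0∞) (μ : Measure (EuclideanSpace ℝ (Fin N)))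
    (v : EuclideanSpace ℝ (Fin N) → ℝ) : ℝ :=
  Classical.epsilon (IsPMean p μ v)

/-- `r_ε(x) = min (ε, dist(x, ∂Ω))`. -/
def rEps {N : ℕ} (ε : ℝ) (Ω : Set (EuclideanSpace ℝ (Fin N))) (x : EuclideanSpace ℝ (Fin N)) : ℝ :=
  min ε (Metric.infDist x (frontier Ω))

open Classical in
/-- The operator `μ_p^ε`: the `p`-mean of `v` on the ball `B_{r_ε(x)}(x)` for `x ∈ Ω`,
and `v x` itself outside of `Ω` (in particular on the boundary, where `r_ε = 0`). -/
def muEps {N : ℕ} (p : ℝ≥0∞) (ε : ℝ) (Ω : Set (EuclideanSpace ℝ (Fin N)))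
    (v : EuclideanSpace ℝ (Fin N) → ℝ) (x : EuclideanSpace ℝ (Fin N)) : ℝ :=
  if x ∈ Ω then pMean p (volume.restrict (Metric.ball x (rEps ε Ω x))) v else v x

/-- The odd power `t ↦ |t|^{p-2} t`. -/
def oddPow (p t : ℝ) : ℝ := |t| ^ (p - 2) * t

lemma oddPow_neg (p t : ℝ) : oddPow p (-t) = -oddPow p t := by
  simp [oddPow]

lemma oddPow_zero (p : ℝ) : oddPow p 0 = 0 := by simp [oddPow]

lemma oddPow_mul {c : ℝ} (hc : 0 < c) (p t : ℝ) :
    oddPow p (c * t) = c ^ (p - 1) * oddPow p t := by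
  have h : c ^ (p - 1) = c ^ (p - 2) * c := by
    rw [← Real.rpow_add_one hc.ne']; ring_nf
  rw [oddPow, oddPow, abs_mul, abs_of_pos hc, Real.mul_rpow hc.le (abs_nonneg t), h]
  ring

lemma measurable_oddPow (p : ℝ) : Measurable (oddPow p) := by
  unfold oddPow
  fun_prop

lemma oddPow_mul_self {p : ℝ} (hp : p ≠ 0) (t : ℝ) : oddPow p t * t = |t| ^ p := by
  rcases eq_or_ne t 0 with rfl | ht
  · simp [oddPow, Real.zero_rpow hp]
  · have h : |t| ^ p = |t| ^ (p - 2) * |t| ^ (2 : ℝ) := by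
      rw [← Real.rpow_add (abs_pos.2 ht)]; ring_nf
    rw [h, Real.rpow_two, sq_abs, oddPow]; ring

lemma abs_oddPow {p : ℝ} (t : ℝ) (ht : t ≠ 0) : |oddPow p t| = |t| ^ (p - 1) := by
  have h : |t| ^ (p - 1) = |t| ^ (p - 2) * |t| := by
    rw [← Real.rpow_add_one (abs_pos.2 ht).ne']; ring_nf
  rw [oddPow, abs_mul, abs_of_nonneg (Real.rpow_nonneg (abs_nonneg t) _), h]

lemma abs_oddPow_le {p : ℝ} (hp : 1 ≤ p) {t M : ℝ} (h : |t| ≤ M) :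
    |oddPow p t| ≤ M ^ (p - 1) := by
  rcases eq_or_ne t 0 with rfl | ht
  · rw [oddPow_zero, abs_zero]
    exact Real.rpow_nonneg ((abs_nonneg _).trans h) _
  · rw [abs_oddPow t ht]
    exact Real.rpow_le_rpow (abs_nonneg t) h (by linarith)

/-- The tangent line inequality for the convex function `|t|^p`. -/
lemma abs_rpow_add_mul_oddPow_le {p : ℝ} (hp : 1 ≤ p) (a b : ℝ) :
    |a| ^ p + p * oddPow p a * (b - a) ≤ |b| ^ p := by
  have hp0 : p ≠ 0 := by linarith
  rcases eq_or_ne a 0 with rfl | ha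
  · simp only [oddPow_zero, abs_zero, Real.zero_rpow hp0]
    have := Real.rpow_nonneg (abs_nonneg b) p
    linarith
  · have ha' : 0 < |a| := abs_pos.2 ha
    have hB := one_add_mul_self_le_rpow_one_add (s := |b| / |a| - 1)
      (by have : 0 ≤ |b| / |a| := by positivity
          linarith) hp
    have h1 : |b| = |a| * (1 + (|b| / |a| - 1)) := by field_simp; ring
    have h2 : |b| ^ p = |a| ^ p * (1 + (|b| / |a| - 1)) ^ p := by
      conv_lhs => rw [h1]
      rw [Real.mul_rpow ha'.le]
      have : 0 ≤ |b| / |a| := by positivity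
      linarith
    have h3 := mul_le_mul_of_nonneg_left hB (Real.rpow_nonneg ha'.le p)
    have h4 : |a| ^ p = |a| ^ (p - 1) * |a| := by
      rw [← Real.rpow_add_one ha'.ne']; ring_nf
    have h5 : oddPow p a * b ≤ |a| ^ (p - 1) * |b| := by
      rw [← abs_oddPow a ha, ← abs_mul]
      exact le_abs_self _
    have h6 := oddPow_mul_self hp0 a
    have h7 : |a| ^ p * (1 + p * (|b| / |a| - 1)) =
        |a| ^ p + p * (|a| ^ (p - 1) * |b|) - p * |a| ^ p := by
      rw [h4]; field_simp; ring
    have h8 := mul_le_mul_of_nonneg_left h5 (by linarith : (0 : ℝ) ≤ p)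
    rw [h2]
    nlinarith

lemma hasDerivAt_oddPow (p : ℝ) {t : ℝ} (ht : t ≠ 0) :
    HasDerivAt (oddPow p) ((p - 1) * |t| ^ (p - 2)) t := by
  have key : ∀ t : ℝ, 0 < t → HasDerivAt (oddPow p) ((p - 1) * |t| ^ (p - 2)) t := by
    intro t ht
    have h := Real.hasDerivAt_rpow_const (x := t) (p := p - 1) (Or.inl ht.ne')
    have e : p - 1 - 1 = p - 2 := by ring
    rw [abs_of_pos ht, ← e]
    refine h.congr_of_eventuallyEq ?_
    filter_upwards [lt_mem_nhds ht] with x hx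
    rw [oddPow, abs_of_pos hx, ← Real.rpow_add_one hx.ne']
    ring_nf
  rcases ht.lt_or_gt with h | h
  · have h1 := (key (-t) (by linarith)).scomp t (hasDerivAt_neg t)
    have h2 := h1.neg
    rw [abs_neg] at h2
    refine (h2.congr_deriv (by simp)).congr_of_eventuallyEq (Eventually.of_forall fun x => ?_)
    simp [oddPow_neg]
  · exact key t h

lemma continuous_oddPow {p : ℝ} (hp : 1 < p) : Continuous (oddPow p) := by
  rw [continuous_iff_continuousAt]
  intro t
  rcases eq_or_ne t 0 with rfl | ht
  · rw [ContinuousAt, oddPow_zero]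
    have h : Tendsto (fun t : ℝ => |t| ^ (p - 1)) (𝓝 0) (𝓝 0) := by
      have : Continuous fun t : ℝ => |t| ^ (p - 1) :=
        continuous_abs.rpow_const fun _ => Or.inr (by linarith)
      simpa [Real.zero_rpow (by linarith : p - 1 ≠ 0)] using this.tendsto 0
    exact squeeze_zero_norm (fun t => abs_oddPow_le hp.le le_rfl) h
  · exact (hasDerivAt_oddPow p ht).continuousAt

lemma rpow_le_add_of_mem_Icc {a b x : ℝ} (ha : 0 < a) (hx : x ∈ Set.Icc a b) (q : ℝ) :
    x ^ q ≤ a ^ q + b ^ q := by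
  have hb : 0 < b := ha.trans_le (hx.1.trans hx.2)
  rcases le_total 0 q with h | h
  · have := Real.rpow_le_rpow (ha.le.trans hx.1) hx.2 h
    have := Real.rpow_nonneg ha.le q
    linarith
  · have := Real.rpow_le_rpow_of_nonpos ha hx.1 h
    have := Real.rpow_nonneg hb.le q
    linarith

/-- A Lipschitz-type bound for `oddPow p` that degenerates at the origin like `|t|^{p-2}`. -/
lemma exists_abs_oddPow_add_sub_le {p : ℝ} (hp : 1 ≤ p) :
    ∃ C : ℝ, 0 ≤ C ∧ ∀ t d : ℝ, t ≠ 0 → |t| ≤ 1 → |d| ≤ 1 →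
      |oddPow p (t + d) - oddPow p t| ≤ C * |d| * (|t| ^ (p - 2) + 1) := by
  set A : ℝ := (1 / 2 : ℝ) ^ (p - 2) with hA
  set B : ℝ := (3 / 2 : ℝ) ^ (p - 2) with hB
  set D : ℝ := (3 : ℝ) ^ (p - 1) with hD
  have hA0 : 0 ≤ A := by positivity
  have hB0 : 0 ≤ B := by positivity
  have hD0 : 0 ≤ D := by positivity
  refine ⟨(p - 1) * (A + B) + 2 * D * (A + 1), by
    have : 0 ≤ p - 1 := by linarith
    positivity, fun t d ht ht1 hd1 => ?_⟩
  have ht' : 0 < |t| := abs_pos.2 ht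
  set T : ℝ := |t| ^ (p - 2) with hT
  have hT0 : 0 ≤ T := Real.rpow_nonneg ht'.le _
  have hAt : (|t| / 2) ^ (p - 2) = A * T := by
    rw [hA, hT, ← Real.mul_rpow (by norm_num) ht'.le]; congr 1; ring
  have hBt : (3 / 2 * |t|) ^ (p - 2) = B * T := by
    rw [hB, hT, ← Real.mul_rpow (by norm_num) ht'.le]
  have hp1 : 0 ≤ p - 1 := by linarith
  have hd0 := abs_nonneg d
  rcases le_or_gt |d| (|t| / 2) with h | h
  · have hseg : ∀ x ∈ Set.Icc (t - |t| / 2) (t + |t| / 2),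
        |x| ∈ Set.Icc (|t| / 2) (3 / 2 * |t|) := by
      intro x hx
      have hxt : |x - t| ≤ |t| / 2 := abs_le.2 ⟨by linarith [hx.1], by linarith [hx.2]⟩
      have h1 := abs_sub_abs_le_abs_sub x t
      have h2 := abs_sub_abs_le_abs_sub t x
      rw [abs_sub_comm] at h2
      constructor <;> linarith
    have hmv := Convex.norm_image_sub_le_of_norm_hasDerivWithin_le
      (f := oddPow p) (f' := fun x => (p - 1) * |x| ^ (p - 2))
      (s := Set.Icc (t - |t| / 2) (t + |t| / 2)) (x := t) (y := t + d)
      (C := (p - 1) * ((A + B) * T))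
      (fun x hx => (hasDerivAt_oddPow p (by
        have := (hseg x hx).1
        exact abs_pos.1 (by linarith))).hasDerivWithinAt)
      (fun x hx => by
        rw [Real.norm_eq_abs, abs_mul, abs_of_nonneg hp1,
          abs_of_nonneg (Real.rpow_nonneg (abs_nonneg x) _)]
        have := rpow_le_add_of_mem_Icc (by linarith) (hseg x hx) (p - 2)
        rw [hAt, hBt] at this
        exact mul_le_mul_of_nonneg_left (by linarith) hp1)
      (convex_Icc _ _) ⟨by linarith, by linarith⟩
      (by obtain ⟨h1, h2⟩ := abs_le.1 h
          exact ⟨by linarith, by linarith⟩)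
    rw [Real.norm_eq_abs, Real.norm_eq_abs, add_sub_cancel_left] at hmv
    refine hmv.trans ?_
    have e : ((p - 1) * (A + B) + 2 * D * (A + 1)) * |d| * (T + 1) =
      (p - 1) * ((A + B) * T) * |d| +
        ((p - 1) * (A + B) * |d| + 2 * D * (A + 1) * |d| * (T + 1)) := by ring
    rw [e]
    have : 0 ≤ (p - 1) * (A + B) * |d| + 2 * D * (A + 1) * |d| * (T + 1) := by positivity
    linarith
  · have hdpos : 0 < |d| := by linarith
    have h1 : |oddPow p (t + d)| ≤ (3 * |d|) ^ (p - 1) :=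
      abs_oddPow_le hp (by linarith [abs_add_le t d])
    have h2 : |oddPow p t| ≤ (3 * |d|) ^ (p - 1) := abs_oddPow_le hp (by linarith)
    have h3 : (3 * |d|) ^ (p - 1) = D * (|d| ^ (p - 2) * |d|) := by
      rw [Real.mul_rpow (by norm_num) hd0, ← Real.rpow_add_one hdpos.ne']
      congr 2; ring
    have h4 : |d| ^ (p - 2) ≤ A * T + 1 := by
      have := rpow_le_add_of_mem_Icc (by linarith) (⟨h.le, hd1⟩ : |d| ∈ Set.Icc _ _) (p - 2)
      rwa [hAt, Real.one_rpow] at this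
    have h5 : |oddPow p (t + d) - oddPow p t| ≤ 2 * D * (|d| ^ (p - 2) * |d|) := by
      have := abs_sub (oddPow p (t + d)) (oddPow p t)
      rw [h3] at h1 h2
      linarith
    have h6 : 2 * D * (|d| ^ (p - 2) * |d|) ≤ 2 * D * ((A * T + 1) * |d|) := by gcongr
    have e : ((p - 1) * (A + B) + 2 * D * (A + 1)) * |d| * (T + 1) =
      2 * D * ((A * T + 1) * |d|) + ((p - 1) * (A + B) * |d| * (T + 1) +
        2 * D * (A + T) * |d|) := by ring
    rw [e]
    have : 0 ≤ (p - 1) * (A + B) * |d| * (T + 1) + 2 * D * (A + T) * |d| := by positivity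
    linarith

section PMean

variable {N : ℕ} {μ : Measure (EuclideanSpace ℝ (Fin N))} {v : EuclideanSpace ℝ (Fin N) → ℝ}

lemma memLp_sub_const [IsFiniteMeasure μ] {M : ℝ} (hv : Measurable v)
    (hM : ∀ᵐ y ∂μ, |v y| ≤ M) (p : ℝ≥0∞) (c : ℝ) : MemLp (fun y => v y - c) p μ := by
  refine MemLp.of_bound (hv.sub_const c).aestronglyMeasurable (M + |c|) ?_
  filter_upwards [hM] with y hy
  rw [Real.norm_eq_abs]
  linarith [abs_sub (v y) c]

lemma exists_isPMean [IsFiniteMeasure μ] (hμ : μ ≠ 0) {M : ℝ} (hv : Measurable v)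
    (hM : ∀ᵐ y ∂μ, |v y| ≤ M) {p : ℝ≥0∞} (hp : 1 ≤ p) : ∃ m, IsPMean p μ v m := by
  have : Fact (1 ≤ p) := ⟨hp⟩
  have hV : MemLp v p μ := by simpa using memLp_sub_const hv hM p 0
  have h1 : MemLp (fun _ : EuclideanSpace ℝ (Fin N) => (1 : ℝ)) p μ := memLp_const 1
  set V := hV.toLp v
  set I := h1.toLp (fun _ => (1 : ℝ))
  have hnorm : ∀ c : ℝ, ‖V - c • I‖ = (eLpNorm (fun y => v y - c) p μ).toReal := by
    intro c
    have : V - c • I = (hV.sub (h1.const_smul c)).toLp _ := by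
      rw [MemLp.toLp_sub hV (h1.const_smul c), MemLp.toLp_const_smul]
    rw [this, Lp.norm_toLp]
    congr 2
    ext y
    simp
  have hI : 0 < ‖I‖ := by
    rw [Lp.norm_toLp]
    refine ENNReal.toReal_pos ?_ h1.2.ne
    rw [eLpNorm_const _ (by intro h; simp [h] at hp) hμ]
    have : μ Set.univ ≠ 0 := by simpa using hμ
    have h2 : μ Set.univ ≠ ⊤ := measure_ne_top _ _
    simp [ENNReal.rpow_eq_zero_iff, this, h2]
  have hcont : Continuous fun c : ℝ => ‖V - c • I‖ := by fun_prop
  have hcoer : Tendsto (fun c : ℝ => ‖V - c • I‖) (cocompact ℝ) atTop := by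
    have h2 : Tendsto (fun c : ℝ => ‖c‖ * ‖I‖ - ‖V‖) (cocompact ℝ) atTop :=
      tendsto_atTop_add_const_right _ _ (tendsto_norm_cocompact_atTop.atTop_mul_const hI)
    refine tendsto_atTop_mono (fun c => ?_) h2
    rw [← norm_smul, norm_sub_rev]
    exact norm_sub_norm_le _ _
  obtain ⟨m, hm⟩ := hcont.exists_forall_le hcoer
  refine ⟨m, fun c => ?_⟩
  have := hm c
  rw [hnorm, hnorm] at this
  exact (ENNReal.toReal_le_toReal (memLp_sub_const hv hM p m).2.ne
    (memLp_sub_const hv hM p c).2.ne).1 this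

lemma isPMean_pMean [IsFiniteMeasure μ] (hμ : μ ≠ 0) {M : ℝ} (hv : Measurable v)
    (hM : ∀ᵐ y ∂μ, |v y| ≤ M) {p : ℝ≥0∞} (hp : 1 ≤ p) : IsPMean p μ v (pMean p μ v) :=
  Classical.epsilon_spec (exists_isPMean hμ hv hM hp)

lemma IsPMean.mul_integral_oddPow_nonpos [IsFiniteMeasure μ] {M : ℝ} (hv : Measurable v)
    (hM : ∀ᵐ y ∂μ, |v y| ≤ M) {p : ℝ} (hp : 1 ≤ p) {m : ℝ}
    (hm : IsPMean (ENNReal.ofReal p) μ v m) (c : ℝ) :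
    (c - m) * ∫ y, oddPow p (v y - c) ∂μ ≤ 0 := by
  have hp0 : 0 < p := by linarith
  have hpt : (ENNReal.ofReal p).toReal = p := ENNReal.toReal_ofReal hp0.le
  have hint : ∀ c, Integrable (fun y => |v y - c| ^ p) μ := by
    intro c
    have := (memLp_sub_const hv hM (ENNReal.ofReal p) c).integrable_norm_rpow
      (by simpa using hp0) ENNReal.ofReal_ne_top
    rwa [hpt] at this
  have hodd : Integrable (fun y => oddPow p (v y - c)) μ := by
    refine Integrable.of_bound
      ((measurable_oddPow p).comp (hv.sub_const c)).aestronglyMeasurable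
      ((M + |c|) ^ (p - 1)) ?_
    filter_upwards [hM] with y hy
    exact abs_oddPow_le hp (by linarith [abs_sub (v y) c])
  have hle : ∫ y, |v y - m| ^ p ∂μ ≤ ∫ y, |v y - c| ^ p ∂μ := by
    have h := hm c
    rw [(memLp_sub_const hv hM _ m).eLpNorm_eq_integral_rpow_norm (by simpa using hp0)
      ENNReal.ofReal_ne_top, (memLp_sub_const hv hM _ c).eLpNorm_eq_integral_rpow_norm
      (by simpa using hp0) ENNReal.ofReal_ne_top, hpt] at h
    simp only [Real.norm_eq_abs] at h
    have h0 : ∀ c, 0 ≤ ∫ y, |v y - c| ^ p ∂μ := fun c =>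
      integral_nonneg fun y => Real.rpow_nonneg (abs_nonneg _) _
    rw [ENNReal.ofReal_le_ofReal_iff (Real.rpow_nonneg (h0 c) _)] at h
    exact (Real.rpow_le_rpow_iff (h0 m) (h0 c) (inv_pos.2 hp0)).1 h
  have hmono : ∫ y, (|v y - c| ^ p + p * (c - m) * oddPow p (v y - c)) ∂μ ≤
      ∫ y, |v y - m| ^ p ∂μ := by
    refine integral_mono ((hint c).add (hodd.const_mul _)) (hint m) fun y => ?_
    have := abs_rpow_add_mul_oddPow_le hp (v y - c) (v y - m)
    simp only
    calc _ = |v y - c| ^ p + p * oddPow p (v y - c) * (v y - m - (v y - c)) := by ring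
      _ ≤ _ := this
  rw [integral_add (hint c) (hodd.const_mul _), integral_const_mul] at hmono
  have h : p * ((c - m) * ∫ y, oddPow p (v y - c) ∂μ) ≤ 0 := by linarith
  by_contra hcon
  have := mul_pos hp0 (not_le.1 hcon)
  linarith

lemma IsPMean.le_of_integral_oddPow_pos [IsFiniteMeasure μ] {M : ℝ} (hv : Measurable v)
    (hM : ∀ᵐ y ∂μ, |v y| ≤ M) {p : ℝ} (hp : 1 ≤ p) {m : ℝ}
    (hm : IsPMean (ENNReal.ofReal p) μ v m) {c : ℝ}
    (hc : 0 < ∫ y, oddPow p (v y - c) ∂μ) : c ≤ m := by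
  have := nonpos_of_mul_nonpos_left (hm.mul_integral_oddPow_nonpos hv hM hp c) hc
  linarith

lemma IsPMean.le_of_integral_oddPow_neg [IsFiniteMeasure μ] {M : ℝ} (hv : Measurable v)
    (hM : ∀ᵐ y ∂μ, |v y| ≤ M) {p : ℝ} (hp : 1 ≤ p) {m : ℝ}
    (hm : IsPMean (ENNReal.ofReal p) μ v m) {c : ℝ}
    (hc : ∫ y, oddPow p (v y - c) ∂μ < 0) : m ≤ c := by
  have := hm.mul_integral_oddPow_nonpos hv hM hp c
  by_contra hcon
  have := mul_pos_of_neg_of_neg (sub_neg.2 (not_le.1 hcon)) hc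
  linarith

end PMean

section Infinity

variable {N : ℕ}

/-- A minimizer for `p = ∞` lies above `c` if the values `≥ c` reach as far from `c` as all
values do. -/
lemma IsPMean.le_of_top {μ : Measure (EuclideanSpace ℝ (Fin N))}
    {v : EuclideanSpace ℝ (Fin N) → ℝ} {m c M : ℝ} (hm : IsPMean ∞ μ v m) (hMc : c ≤ M)
    (hle : ∀ᵐ y ∂μ, |v y - c| ≤ M - c) (hsup : ∀ t < M, ∃ᵐ y ∂μ, t < v y) : c ≤ m := by
  by_contra hcon
  rw [not_le] at hcon
  have h1 : eLpNorm (fun y => v y - c) ∞ μ ≤ ENNReal.ofReal (M - c) := by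
    rw [eLpNorm_exponent_top]
    exact eLpNormEssSup_le_of_ae_bound hle
  have h2 := (hm c).trans h1
  rw [eLpNorm_exponent_top] at h2
  have h3 : ∀ᵐ y ∂μ, ‖v y - m‖ₑ ≤ ENNReal.ofReal (M - c) := by
    filter_upwards [ae_le_eLpNormEssSup (f := fun y => v y - m) (μ := μ)] with y hy
    exact hy.trans h2
  refine hsup (M - (c - m)) (by linarith) ?_
  filter_upwards [h3] with y hy
  rw [← ofReal_norm, ENNReal.ofReal_le_ofReal_iff (by linarith), Real.norm_eq_abs] at hy
  have := (abs_le.1 hy).2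
  linarith

lemma one_sub_mul_le_one_add_rpow_neg {α s : ℝ} (hα : 0 < α) (hs : -1 < s) :
    1 - α * s ≤ (1 + s) ^ (-α) := by
  have h0 : 0 < 1 + s := by linarith
  rw [Real.rpow_def_of_pos h0]
  have h1 := Real.add_one_le_exp (Real.log (1 + s) * -α)
  have h2 := Real.log_le_sub_one_of_pos h0
  nlinarith

lemma rpow_neg_le_half_add {α a s : ℝ} (hα : 0 < α) (hs : 0 ≤ s) (hsa : s < a) :
    a ^ (-α) ≤ ((a - s) ^ (-α) + (a + s) ^ (-α)) / 2 := by
  have ha : 0 < a := by linarith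
  have hq : s / a < 1 := (div_lt_one ha).2 hsa
  have hq0 : 0 ≤ s / a := by positivity
  have e1 : a - s = a * (1 + -(s / a)) := by field_simp; ring
  have e2 : a + s = a * (1 + s / a) := by field_simp
  rw [e1, e2, Real.mul_rpow ha.le (by linarith), Real.mul_rpow ha.le (by linarith)]
  have h1 := one_sub_mul_le_one_add_rpow_neg (s := -(s / a)) hα (by linarith)
  have h2 := one_sub_mul_le_one_add_rpow_neg (s := s / a) hα (by linarith)
  have := Real.rpow_nonneg ha.le (-α)
  nlinarith

end Infinity

section UnitBall

variable {N : ℕ}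

lemma setIntegral_ball_comp_linearIsometryEquiv
    (U : EuclideanSpace ℝ (Fin N) ≃ₗᵢ[ℝ] EuclideanSpace ℝ (Fin N))
    (f : EuclideanSpace ℝ (Fin N) → ℝ) (r : ℝ) :
    ∫ z in ball 0 r, f (U z) = ∫ z in ball 0 r, f z := by
  have h := U.measurePreserving.setIntegral_preimage_emb
    U.toHomeomorph.measurableEmbedding f (ball 0 r)
  rwa [LinearIsometryEquiv.preimage_ball, map_zero] at h

lemma abs_apply_le_one {z : EuclideanSpace ℝ (Fin N)} (hz : z ∈ ball 0 1) (i : Fin N) :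
    |z i| ≤ 1 := by
  rw [mem_ball_zero_iff] at hz
  exact (PiLp.norm_apply_le z i).trans hz.le

lemma ae_ball_apply_ne_zero (i : Fin N) :
    ∀ᵐ z : EuclideanSpace ℝ (Fin N) ∂(volume.restrict (ball 0 1)), z i ≠ 0 := by
  refine ae_restrict_of_ae ?_
  let f : EuclideanSpace ℝ (Fin N) →ₗ[ℝ] ℝ := (EuclideanSpace.proj i).toLinearMap
  have hf : LinearMap.ker f ≠ ⊤ := by
    intro h
    have h1 : EuclideanSpace.single i (1 : ℝ) ∈ LinearMap.ker f := h ▸ Submodule.mem_top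
    simp [f] at h1
  have := Measure.addHaar_submodule volume _ hf
  rw [ae_iff]
  convert this using 2
  ext z
  simp [f]

lemma integrableOn_Icc_abs_rpow {q : ℝ} (hq : -1 < q) :
    IntegrableOn (fun t : ℝ => |t| ^ q) (Set.Icc (-1) 1) := by
  have h1 : IntervalIntegrable (fun t : ℝ => |t| ^ q) volume 0 1 := by
    refine (intervalIntegral.intervalIntegrable_rpow' (a := 0) (b := 1) hq).congr ?_
    intro t ht
    rw [Set.uIoc_of_le zero_le_one] at ht
    simp only [abs_of_pos ht.1]
  have h2 : IntervalIntegrable (fun t : ℝ => |t| ^ q) volume (-1) 0 := by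
    have := ((IntervalIntegrable.iff_comp_neg enorm_ne_top).1 h1).symm
    simpa using this
  exact (intervalIntegrable_iff_integrableOn_Icc_of_le (by norm_num)).1 (h2.trans h1)

lemma integrableOn_ball_abs_apply_rpow {q : ℝ} (hq : -1 < q) (i : Fin N) :
    IntegrableOn (fun z : EuclideanSpace ℝ (Fin N) => |z i| ^ q) (ball 0 1) := by
  classical
  let F : Fin N → ℝ → ℝ := fun j =>
    (Set.Icc (-1 : ℝ) 1).indicator (if j = i then fun t => |t| ^ q else fun _ => 1)
  have hF : ∀ j, Integrable (F j) volume := by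
    intro j
    rw [integrable_indicator_iff measurableSet_Icc]
    split_ifs
    · exact integrableOn_Icc_abs_rpow hq
    · exact integrableOn_const (by simp)
  have h1 : Integrable (fun x : Fin N → ℝ => ∏ j, F j (x j)) volume :=
    Integrable.fintype_prod hF
  have h2 := (PiLp.volume_preserving_ofLp (Fin N)).integrable_comp_of_integrable h1
  refine (h2.integrableOn (s := ball 0 1)).congr_fun (fun z hz => ?_) measurableSet_ball
  have h3 : ∀ j, F j (z j) = if j = i then |z j| ^ q else 1 := by
    intro j
    have : z j ∈ Set.Icc (-1 : ℝ) 1 := abs_le.1 (abs_apply_le_one hz j)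
    simp only [F, Set.indicator_of_mem this]
    split_ifs <;> rfl
  simp only [Function.comp, h3]
  rw [Finset.prod_ite_eq' Finset.univ i (fun j => |z j| ^ q)]
  simp

/-- Differentiation of `∫ oddPow p (z i + δ s z) * k z` at `s = 0`. -/
lemma tendsto_integral_oddPow_slope {p : ℝ} (hp : 1 < p) (i : Fin N)
    {δ : ℝ → EuclideanSpace ℝ (Fin N) → ℝ} {Q k : EuclideanSpace ℝ (Fin N) → ℝ} {C : ℝ}
    (hδm : ∀ s, Measurable (δ s)) (hkm : Measurable k) (hk : ∀ z ∈ ball 0 1, |k z| ≤ 1)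
    (hδ : ∀ᶠ s in 𝓝[>] (0 : ℝ), ∀ z ∈ ball 0 1, |δ s z| ≤ C * s)
    (hQ : ∀ z ∈ ball 0 1, Tendsto (fun s => s⁻¹ * δ s z) (𝓝[>] 0) (𝓝 (Q z))) :
    Tendsto (fun s => s⁻¹ * ∫ z in ball 0 1, (oddPow p (z i + δ s z) - oddPow p (z i)) * k z)
      (𝓝[>] 0) (𝓝 (∫ z in ball 0 1, (p - 1) * |z i| ^ (p - 2) * Q z * k z)) := by
  obtain ⟨D, hD0, hD⟩ := exists_abs_oddPow_add_sub_le hp.le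
  simp_rw [← integral_const_mul]
  have hpos : ∀ᶠ s in 𝓝[>] (0 : ℝ), 0 < s := self_mem_nhdsWithin
  have hto0 : Tendsto (fun s : ℝ => C * s) (𝓝[>] 0) (𝓝 0) := by
    have : Tendsto (fun s : ℝ => C * s) (𝓝 0) (𝓝 (C * 0)) := by
      exact (continuous_const.mul continuous_id).tendsto 0
    rw [mul_zero] at this
    exact this.mono_left nhdsWithin_le_nhds
  have hsmall : ∀ᶠ s in 𝓝[>] (0 : ℝ), C * s ≤ 1 := hto0.eventually (ge_mem_nhds one_pos)
  refine tendsto_integral_filter_of_dominated_convergence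
    (fun z => D * C * (|z i| ^ (p - 2) + 1)) ?_ ?_ ?_ ?_
  · refine Eventually.of_forall fun s => Measurable.aestronglyMeasurable ?_
    have h1 := measurable_oddPow p
    have h2 := hδm s
    have h3 : Measurable fun z : EuclideanSpace ℝ (Fin N) => z i := by fun_prop
    exact (((h1.comp (h3.add h2)).sub (h1.comp h3)).mul hkm).const_mul _
  · filter_upwards [hpos, hδ, hsmall] with s hs hs1 hs2
    filter_upwards [ae_ball_apply_ne_zero i, ae_restrict_mem measurableSet_ball] with z hz0 hz
    have hb := hD (z i) (δ s z) hz0 (abs_apply_le_one hz i) ((hs1 z hz).trans hs2)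
    have hT : 0 ≤ |z i| ^ (p - 2) := Real.rpow_nonneg (abs_nonneg _) _
    rw [Real.norm_eq_abs, abs_mul, abs_mul, abs_of_pos (inv_pos.2 hs)]
    calc s⁻¹ * (|oddPow p (z i + δ s z) - oddPow p (z i)| * |k z|)
        ≤ s⁻¹ * ((D * (C * s) * (|z i| ^ (p - 2) + 1)) * 1) := by
          have h4 := hs1 z hz
          have h5 := hk z hz
          have : 0 ≤ C * s := (abs_nonneg _).trans h4
          gcongr
          refine hb.trans ?_
          gcongr
      _ = D * C * (|z i| ^ (p - 2) + 1) := by field_simp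
  · exact ((integrableOn_ball_abs_apply_rpow (by linarith) i).add
      (integrableOn_const measure_ball_lt_top.ne)).const_mul _
  · filter_upwards [ae_ball_apply_ne_zero i, ae_restrict_mem measurableSet_ball] with z hz0 hz
    have hlim : Tendsto (fun s => δ s z) (𝓝[>] 0) (𝓝 0) := by
      refine squeeze_zero_norm' ?_ hto0
      filter_upwards [hδ] with s hs using hs z hz
    have h := (hasDerivAt_oddPow p hz0).hasFDerivAt.hasFDerivWithinAt (s := Set.univ)
      |>.lim hlim (Eventually.of_forall fun _ => Set.mem_univ _)
        (by simpa only [smul_eq_mul] using hQ z hz)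
    have h' := h.mul_const (k z)
    simp only [smul_eq_mul, ContinuousLinearMap.toSpanSingleton_apply] at h'
    convert h' using 1
    · ext s; ring
    · congr 1; ring

lemma integral_ball_oddPow_apply (p : ℝ) (i : Fin N) :
    ∫ z : EuclideanSpace ℝ (Fin N) in ball 0 1, oddPow p (z i) = 0 := by
  have h := setIntegral_ball_comp_linearIsometryEquiv (LinearIsometryEquiv.neg ℝ)
    (fun z : EuclideanSpace ℝ (Fin N) => oddPow p (z i)) 1
  simp only [LinearIsometryEquiv.coe_neg, PiLp.neg_apply, oddPow_neg, integral_neg] at h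
  linarith

lemma integral_ball_abs_apply_rpow_pos {p : ℝ} (hp : -1 < p) (i : Fin N) :
    0 < ∫ z : EuclideanSpace ℝ (Fin N) in ball 0 1, |z i| ^ p := by
  rw [integral_pos_iff_support_of_nonneg_ae
    (Eventually.of_forall fun z => Real.rpow_nonneg (abs_nonneg _) _)
    (integrableOn_ball_abs_apply_rpow hp i)]
  have h1 : 0 < (volume.restrict (ball (0 : EuclideanSpace ℝ (Fin N)) 1)) Set.univ := by
    rw [Measure.restrict_apply_univ]
    exact measure_ball_pos _ _ one_pos
  refine h1.trans_le (measure_mono_ae ?_)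
  filter_upwards [ae_ball_apply_ne_zero i] with z hz _
  exact (Real.rpow_pos_of_pos (abs_pos.2 hz) p).ne'

/-- Reflection across the hyperplane orthogonal to `b`. -/
lemma integral_ball_comp_inner_mul_inner_eq_zero {a b : EuclideanSpace ℝ (Fin N)}
    (hab : inner ℝ b a = 0) (f : ℝ → ℝ) :
    ∫ z : EuclideanSpace ℝ (Fin N) in ball 0 1, f (inner ℝ a z) * inner ℝ b z = 0 := by
  have h := setIntegral_ball_comp_linearIsometryEquiv (ℝ ∙ b)ᗮ.reflection
    (fun z => f (inner ℝ a z) * inner ℝ b z) 1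
  have hb : (ℝ ∙ b)ᗮ.reflection b = -b :=
    Submodule.reflection_orthogonalComplement_singleton_eq_neg b
  have ha : (ℝ ∙ b)ᗮ.reflection a = a :=
    Submodule.reflection_mem_subspace_eq_self (Submodule.mem_orthogonal_singleton_iff_inner_right.2 hab)
  have key : ∀ w z, inner ℝ w ((ℝ ∙ b)ᗮ.reflection z) = inner ℝ ((ℝ ∙ b)ᗮ.reflection w) z := by
    intro w z
    rw [← LinearIsometryEquiv.inner_map_map (ℝ ∙ b)ᗮ.reflection w, Submodule.reflection_reflection]
  simp only [key, ha, hb, inner_neg_left, mul_neg, integral_neg] at h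
  linarith

lemma mul_integral_ball_abs_rpow_mul_sq {p : ℝ} (hp : 1 < p) {i j : Fin N} (hij : i ≠ j) :
    ∫ z : EuclideanSpace ℝ (Fin N) in ball 0 1, (p - 1) * |z i| ^ (p - 2) * z j * z j =
      ∫ z : EuclideanSpace ℝ (Fin N) in ball 0 1, |z i| ^ p := by
  have hcont := continuous_oddPow hp
  have hci : ∀ l : Fin N, Continuous fun z : EuclideanSpace ℝ (Fin N) => z l := by
    intro l; fun_prop
  have hint : ∀ (t : ℝ) (l : Fin N),
      IntegrableOn (fun z : EuclideanSpace ℝ (Fin N) => oddPow p (z i + t * z j) * z l)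
        (ball 0 1) := by
    intro t l
    have : Continuous fun z : EuclideanSpace ℝ (Fin N) => oddPow p (z i + t * z j) * z l :=
      (hcont.comp ((hci i).add ((hci j).const_mul t))).mul (hci l)
    exact (this.continuousOn.integrableOn_compact (isCompact_closedBall 0 1)).mono_set
      ball_subset_closedBall
  have hrefl : ∀ t : ℝ, ∫ z : EuclideanSpace ℝ (Fin N) in ball 0 1,
      oddPow p (z i + t * z j) * (z j - t * z i) = 0 := by
    intro t
    have h := integral_ball_comp_inner_mul_inner_eq_zero
      (a := EuclideanSpace.single i (1 : ℝ) + t • EuclideanSpace.single j (1 : ℝ))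
      (b := EuclideanSpace.single j (1 : ℝ) - t • EuclideanSpace.single i (1 : ℝ))
      (by simp [inner_add_right, inner_sub_left, inner_smul_left, inner_smul_right, hij,
            hij.symm, EuclideanSpace.inner_single_left]) (oddPow p)
    simpa [inner_add_left, inner_sub_left, inner_smul_left,
      EuclideanSpace.inner_single_left] using h
  have hzero : ∫ z : EuclideanSpace ℝ (Fin N) in ball 0 1, oddPow p (z i) * z j = 0 := by
    simpa using hrefl 0
  have heq : ∀ t : ℝ, ∫ z : EuclideanSpace ℝ (Fin N) in ball 0 1,
      (oddPow p (z i + t * z j) - oddPow p (z i)) * z j =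
        t * ∫ z : EuclideanSpace ℝ (Fin N) in ball 0 1, oddPow p (z i + t * z j) * z i := by
    intro t
    have h1 : ∫ z : EuclideanSpace ℝ (Fin N) in ball 0 1,
        (oddPow p (z i + t * z j) - oddPow p (z i)) * z j =
        ∫ z : EuclideanSpace ℝ (Fin N) in ball 0 1, oddPow p (z i + t * z j) * z j := by
      simp_rw [sub_mul]
      have h0 := hint 0 j
      simp only [zero_mul, add_zero] at h0
      rw [integral_sub (hint t j) h0, hzero, sub_zero]
    have h2 := hrefl t
    simp_rw [mul_sub] at h2
    have h3 : IntegrableOn (fun z : EuclideanSpace ℝ (Fin N) =>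
        oddPow p (z i + t * z j) * (t * z i)) (ball 0 1) := by
      refine ((hint t i).const_mul t).congr (Eventually.of_forall fun z => ?_)
      simp only
      ring
    rw [integral_sub (hint t j) h3, sub_eq_zero] at h2
    rw [h1, h2, ← integral_const_mul]
    congr 1
    ext z
    ring
  have hlim := tendsto_integral_oddPow_slope hp i (δ := fun t z => t * z j) (Q := fun z => z j)
    (k := fun z => z j) (C := 1) (fun s => ((hci j).const_mul s).measurable)
    (hci j).measurable (fun z hz => abs_apply_le_one hz j)
    (by
      filter_upwards [self_mem_nhdsWithin] with s hs z hz
      have hs' : 0 < s := hs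
      rw [abs_mul, abs_of_pos hs', one_mul]
      exact mul_le_of_le_one_right hs'.le (abs_apply_le_one hz j))
    (by
      intro z _
      refine tendsto_const_nhds.congr' ?_
      filter_upwards [self_mem_nhdsWithin] with s hs
      have hs' : 0 < s := hs
      field_simp)
  have hlim2 : Tendsto (fun t : ℝ => ∫ z : EuclideanSpace ℝ (Fin N) in ball 0 1,
      oddPow p (z i + t * z j) * z i) (𝓝[>] 0)
      (𝓝 (∫ z : EuclideanSpace ℝ (Fin N) in ball 0 1, |z i| ^ p)) := by
    refine tendsto_integral_filter_of_dominated_convergence (fun _ => 2 ^ (p - 1)) ?_ ?_ ?_ ?_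
    · exact Eventually.of_forall fun t => (hint t i).aestronglyMeasurable
    · have h1 : ∀ᶠ t in 𝓝[>] (0 : ℝ), t < 1 :=
        (gt_mem_nhds (one_pos : (0 : ℝ) < 1)).filter_mono nhdsWithin_le_nhds
      filter_upwards [self_mem_nhdsWithin, h1] with t ht ht1
      have ht' : 0 < t := ht
      filter_upwards [ae_restrict_mem measurableSet_ball] with z hz
      have hzi := abs_apply_le_one hz i
      have hzj := abs_apply_le_one hz j
      have h2 : |z i + t * z j| ≤ 2 := by
        have h3 := abs_add_le (z i) (t * z j)
        rw [abs_mul, abs_of_pos ht'] at h3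
        nlinarith [abs_nonneg (z j)]
      rw [norm_mul]
      exact (mul_le_of_le_one_right (norm_nonneg _) hzi).trans (abs_oddPow_le hp.le h2)
    · exact integrableOn_const measure_ball_lt_top.ne
    · refine Eventually.of_forall fun z => ?_
      have h1 : Continuous fun t : ℝ => oddPow p (z i + t * z j) * z i := by
        have := hcont
        fun_prop
      have h2 := h1.tendsto 0
      simp only [zero_mul, add_zero, oddPow_mul_self (by linarith : p ≠ 0)] at h2
      exact h2.mono_left nhdsWithin_le_nhds
  refine tendsto_nhds_unique hlim (hlim2.congr' ?_)
  filter_upwards [self_mem_nhdsWithin] with s hs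
  have hs' : 0 < s := hs
  rw [heq s]
  field_simp

lemma exists_taylor_one_add_rpow {α : ℝ} (hα : 0 < α) :
    ∃ R : ℝ → ℝ, ContinuousAt R 0 ∧ R 0 = -(α + 2) / 8 ∧
      ∀ τ, (1 - (1 + τ) ^ (-α / 2)) / α = τ / 2 + R τ * τ ^ 2 := by
  have hder : ∀ b τ : ℝ, -1 < τ →
      HasDerivAt (fun τ : ℝ => (1 + τ) ^ b) (b * (1 + τ) ^ (b - 1)) τ := by
    intro b τ hτ
    have := ((hasDerivAt_id τ).const_add 1).rpow_const (p := b)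
      (Or.inl (by simp only [id]; linarith))
    simpa using this
  have hnear : ∀ᶠ τ in 𝓝[≠] (0 : ℝ), -1 < τ :=
    (lt_mem_nhds (by norm_num)).filter_mono nhdsWithin_le_nhds
  have hne : ∀ᶠ τ in 𝓝[≠] (0 : ℝ), τ ≠ 0 := self_mem_nhdsWithin
  have hlim : Tendsto (fun τ : ℝ => ((1 - (1 + τ) ^ (-α / 2)) / α - τ / 2) / τ ^ 2) (𝓝[≠] 0)
      (𝓝 (-(α + 2) / 8)) := by
    refine HasDerivAt.lhopital_zero_nhdsNE
      (f' := fun τ => (1 / 2) * ((1 + τ) ^ (-α / 2 - 1) - 1)) (g' := fun τ => 2 * τ)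
      ?_ ?_ ?_ ?_ ?_ ?_
    · filter_upwards [hnear] with τ hτ
      have := ((((hder (-α / 2) τ hτ).const_sub 1).div_const α).sub
        ((hasDerivAt_id τ).div_const 2))
      refine this.congr_deriv ?_
      field_simp
    · refine Eventually.of_forall fun τ => ?_
      simpa using hasDerivAt_pow 2 τ
    · filter_upwards [hne] with τ hτ
      simpa using hτ
    · have hc : ContinuousAt (fun τ : ℝ => (1 - (1 + τ) ^ (-α / 2)) / α - τ / 2) 0 :=
        ((((hder (-α / 2) 0 (by norm_num)).const_sub 1).div_const α).sub
          ((hasDerivAt_id 0).div_const 2)).continuousAt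
      have := hc.tendsto
      simp only [add_zero, Real.one_rpow, sub_self, zero_div] at this
      exact this.mono_left nhdsWithin_le_nhds
    · have : Tendsto (fun τ : ℝ => τ ^ 2) (𝓝 0) (𝓝 (0 ^ 2)) := (continuous_pow 2).tendsto 0
      rw [zero_pow two_ne_zero] at this
      exact this.mono_left nhdsWithin_le_nhds
    · have h := (hder (-α / 2 - 1) 0 (by norm_num)).tendsto_slope
      have h2 := h.const_mul (1 / 4 : ℝ)
      have e : (1 / 4 : ℝ) * ((-α / 2 - 1) * (1 + 0) ^ (-α / 2 - 1 - 1)) = -(α + 2) / 8 := by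
        rw [add_zero, Real.one_rpow]; ring
      rw [e] at h2
      refine h2.congr' ?_
      filter_upwards [hne] with τ hτ
      rw [slope_def_field]
      simp only [add_zero, Real.one_rpow, sub_zero]
      field_simp
      ring
  refine ⟨Function.update (fun τ : ℝ => ((1 - (1 + τ) ^ (-α / 2)) / α - τ / 2) / τ ^ 2) 0
    (-(α + 2) / 8), continuousAt_update_same.2 hlim, Function.update_self _ _ _, fun τ => ?_⟩
  rcases eq_or_ne τ 0 with rfl | hτ
  · simp
  · rw [Function.update_of_ne hτ]
    field_simp
    ring

lemma norm_single_add_smul_sq (i : Fin N) (s : ℝ) (z : EuclideanSpace ℝ (Fin N)) :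
    ‖EuclideanSpace.single i (1 : ℝ) + s • z‖ ^ 2 = 1 + (2 * s * z i + s ^ 2 * ‖z‖ ^ 2) := by
  rw [norm_add_sq_real, norm_smul, inner_smul_right, EuclideanSpace.inner_single_left]
  simp [mul_pow]
  ring

lemma norm_single_add_smul_rpow (i : Fin N) (s α : ℝ) (z : EuclideanSpace ℝ (Fin N)) :
    ‖EuclideanSpace.single i (1 : ℝ) + s • z‖ ^ (-α) =
      (1 + (2 * s * z i + s ^ 2 * ‖z‖ ^ 2)) ^ (-α / 2) := by
  rw [← norm_single_add_smul_sq, ← Real.rpow_natCast, ← Real.rpow_mul (norm_nonneg _)]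
  congr 1
  push_cast
  ring

lemma integral_ball_second_order {p : ℝ} (hp : 1 < p) (α : ℝ) (i : Fin N) :
    ∫ z : EuclideanSpace ℝ (Fin N) in ball 0 1,
        (p - 1) * |z i| ^ (p - 2) * (‖z‖ ^ 2 / 2 - (α + 2) / 2 * z i ^ 2) * 1 =
      (α + N - (α + 1) * p) / 2 *
        ∫ z : EuclideanSpace ℝ (Fin N) in ball 0 1, |z i| ^ p := by
  set W := ∫ z : EuclideanSpace ℝ (Fin N) in ball 0 1, |z i| ^ p with hW
  have hj : ∀ j, ∫ z : EuclideanSpace ℝ (Fin N) in ball 0 1,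
      (p - 1) * |z i| ^ (p - 2) * z j * z j = if j = i then (p - 1) * W else W := by
    intro j
    split_ifs with h
    · subst h
      rw [hW, ← integral_const_mul]
      congr 1
      ext z
      rw [← oddPow_mul_self (by linarith : p ≠ 0), oddPow]
      ring
    · exact mul_integral_ball_abs_rpow_mul_sq hp (Ne.symm h)
  have hint : ∀ j, IntegrableOn (fun z : EuclideanSpace ℝ (Fin N) =>
      (p - 1) * |z i| ^ (p - 2) * z j * z j) (ball 0 1) := by
    intro j
    have h1 := (integrableOn_ball_abs_apply_rpow (q := p - 2) (by linarith) i).const_mul (p - 1)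
    refine h1.mono' (Measurable.aestronglyMeasurable (by fun_prop)) ?_
    filter_upwards [ae_restrict_mem measurableSet_ball] with z hz
    have hzj := abs_apply_le_one hz j
    have h0 : 0 ≤ (p - 1) * |z i| ^ (p - 2) :=
      mul_nonneg (by linarith) (Real.rpow_nonneg (abs_nonneg _) _)
    rw [Real.norm_eq_abs, abs_mul, abs_mul, abs_of_nonneg h0]
    exact mul_le_of_le_one_right (mul_nonneg h0 (abs_nonneg _)) hzj |>.trans
      (mul_le_of_le_one_right h0 hzj)
  have hsum : ∑ j, (if j = i then (p - 1) * W else W) = (p + N - 2) * W := by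
    have : ∀ j, (if j = i then (p - 1) * W else W) = W + if j = i then (p - 2) * W else 0 := by
      intro j
      split_ifs <;> ring
    simp_rw [this, Finset.sum_add_distrib]
    simp
    ring
  have hexp : ∀ z : EuclideanSpace ℝ (Fin N),
      (p - 1) * |z i| ^ (p - 2) * (‖z‖ ^ 2 / 2 - (α + 2) / 2 * z i ^ 2) * 1 =
      1 / 2 * (∑ j, (p - 1) * |z i| ^ (p - 2) * z j * z j) -
        (α + 2) / 2 * ((p - 1) * |z i| ^ (p - 2) * z i * z i) := by
    intro z
    have : ∑ j, (p - 1) * |z i| ^ (p - 2) * z j * z j =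
        (p - 1) * |z i| ^ (p - 2) * ‖z‖ ^ 2 := by
      rw [EuclideanSpace.real_norm_sq_eq, Finset.mul_sum]
      exact Finset.sum_congr rfl fun j _ => by ring
    rw [this]
    ring
  simp_rw [hexp]
  rw [integral_sub ((integrable_finsetSum _ fun j _ => hint j).const_mul _)
    ((hint i).const_mul _), integral_const_mul, integral_const_mul,
    integral_finsetSum _ fun j _ => hint j]
  simp_rw [hj]
  rw [hsum]
  simp only [if_true]
  ring

/-- The first nonvanishing term in the expansion, as `s → 0`, of the integral defining the
`p`-mean of `‖·‖^{-α}` on a ball of radius `s` centred at a unit vector. -/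
lemma tendsto_integral_ball_oddPow_gamma {α p : ℝ} (hα : 0 < α) (hp : 1 < p) (i : Fin N) :
    Tendsto (fun s : ℝ => s⁻¹ * ∫ z : EuclideanSpace ℝ (Fin N) in ball 0 1,
        oddPow p ((1 - ‖EuclideanSpace.single i (1 : ℝ) + s • z‖ ^ (-α)) / (α * s))) (𝓝[>] 0)
      (𝓝 ((α + N - (α + 1) * p) / 2 *
        ∫ z : EuclideanSpace ℝ (Fin N) in ball 0 1, |z i| ^ p)) := by
  obtain ⟨R, hRc, hR0, hR⟩ := exists_taylor_one_add_rpow hα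
  set τ : ℝ → EuclideanSpace ℝ (Fin N) → ℝ :=
    fun s z => 2 * s * z i + s ^ 2 * ‖z‖ ^ 2 with hτ
  set δ : ℝ → EuclideanSpace ℝ (Fin N) → ℝ := fun s z =>
    (1 - ‖EuclideanSpace.single i (1 : ℝ) + s • z‖ ^ (-α)) / (α * s) - z i with hδ
  have hδeq : ∀ s z, s ≠ 0 → δ s z = s * (‖z‖ ^ 2 / 2 + R (τ s z) * (τ s z / s) ^ 2) := by
    intro s z hs
    have h := hR (τ s z)
    have h2 : (1 - ‖EuclideanSpace.single i (1 : ℝ) + s • z‖ ^ (-α)) / (α * s) =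
        (1 - (1 + τ s z) ^ (-α / 2)) / α / s := by
      rw [norm_single_add_smul_rpow, div_div]
    simp only [hδ]
    rw [h2, h]
    simp only [hτ]
    field_simp
    ring
  have hτs : ∀ s z, s ≠ 0 → τ s z / s = 2 * z i + s * ‖z‖ ^ 2 := by
    intro s z hs
    simp only [hτ]
    field_simp
  have hτs3 : ∀ s z, 0 < s → s ≤ 1 → z ∈ ball (0 : EuclideanSpace ℝ (Fin N)) 1 →
      |τ s z / s| ≤ 3 := by
    intro s z hs hs1 hz
    rw [hτs s z hs.ne']
    have h1 := abs_apply_le_one hz i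
    rw [mem_ball_zero_iff] at hz
    have h2 := abs_add_le (2 * z i) (s * ‖z‖ ^ 2)
    have h3 : |2 * z i| ≤ 2 := by rw [abs_mul, abs_two]; linarith
    have h4 : ‖z‖ ^ 2 ≤ 1 := pow_le_one₀ (norm_nonneg _) hz.le
    have h5 : |s * ‖z‖ ^ 2| ≤ 1 := by
      rw [abs_of_nonneg (by positivity)]
      exact mul_le_one₀ hs1 (by positivity) h4
    linarith
  set K : ℝ := |R 0| + 1 with hK
  have hRbd : ∀ᶠ x in 𝓝 (0 : ℝ), |R x| ≤ K :=
    (hRc.abs.tendsto.eventually (gt_mem_nhds (by linarith : |R 0| < K))).mono fun _ h => h.le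
  obtain ⟨ε, hε, hRε⟩ := Metric.eventually_nhds_iff.1 hRbd
  have hs1 : ∀ᶠ s in 𝓝[>] (0 : ℝ), s < 1 :=
    (gt_mem_nhds (one_pos : (0 : ℝ) < 1)).filter_mono nhdsWithin_le_nhds
  have hsε : ∀ᶠ s in 𝓝[>] (0 : ℝ), s < ε / 3 :=
    (gt_mem_nhds (by positivity : (0 : ℝ) < ε / 3)).filter_mono nhdsWithin_le_nhds
  have hmain := tendsto_integral_oddPow_slope hp i (δ := δ) (k := fun _ => 1)
    (Q := fun z => ‖z‖ ^ 2 / 2 - (α + 2) / 2 * z i ^ 2) (C := 1 / 2 + K * 9)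
    (fun s => by fun_prop) measurable_const (fun _ _ => by simp)
    (by
      filter_upwards [self_mem_nhdsWithin, hs1, hsε] with s hs hs1 hsε z hz
      have hs' : 0 < s := hs
      have h3 := hτs3 s z hs' hs1.le hz
      have hRτ : |R (τ s z)| ≤ K := by
        refine hRε ?_
        rw [Real.dist_eq, sub_zero]
        rw [abs_div, abs_of_pos hs', div_le_iff₀ hs'] at h3
        linarith
      rw [hδeq s z hs'.ne', abs_mul, abs_of_pos hs', mul_comm]
      refine mul_le_mul_of_nonneg_right ?_ hs'.le
      refine (abs_add_le _ _).trans (add_le_add ?_ ?_)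
      · rw [abs_of_nonneg (by positivity)]
        rw [mem_ball_zero_iff] at hz
        have := pow_le_one₀ (n := 2) (norm_nonneg _) hz.le
        linarith
      · rw [abs_mul, abs_pow]
        have h9 : |τ s z / s| ^ 2 ≤ 9 := by
          have := pow_le_pow_left₀ (abs_nonneg _) h3 2
          linarith
        gcongr)
    (by
      intro z _
      have hτ0 : Tendsto (fun s => τ s z) (𝓝[>] 0) (𝓝 0) := by
        have hc : Continuous fun s => τ s z := by simp only [hτ]; fun_prop
        have := hc.tendsto 0
        simp only [hτ] at this
        simp only [mul_zero, zero_mul, ne_eq, OfNat.ofNat_ne_zero, not_false_eq_true, zero_pow,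
          add_zero] at this
        exact this.mono_left nhdsWithin_le_nhds
      have h1 : Tendsto (fun s => R (τ s z)) (𝓝[>] 0) (𝓝 (R 0)) := hRc.tendsto.comp hτ0
      have h2 : Tendsto (fun s : ℝ => 2 * z i + s * ‖z‖ ^ 2) (𝓝[>] 0) (𝓝 (2 * z i)) := by
        have hc : Continuous fun s : ℝ => 2 * z i + s * ‖z‖ ^ 2 := by fun_prop
        have := hc.tendsto 0
        rw [zero_mul, add_zero] at this
        exact this.mono_left nhdsWithin_le_nhds
      have h3 := (h1.mul (h2.pow 2)).const_add (‖z‖ ^ 2 / 2)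
      rw [hR0] at h3
      have e : ‖z‖ ^ 2 / 2 + -(α + 2) / 8 * (2 * z i) ^ 2 =
        ‖z‖ ^ 2 / 2 - (α + 2) / 2 * z i ^ 2 := by ring
      rw [e] at h3
      refine h3.congr' ?_
      filter_upwards [self_mem_nhdsWithin] with s hs
      have hs' : s ≠ 0 := ne_of_gt hs
      rw [hδeq s z hs', hτs s z hs']
      field_simp)
  rw [integral_ball_second_order hp] at hmain
  refine hmain.congr' ?_
  filter_upwards [self_mem_nhdsWithin, hs1] with s hs hs1
  have hs' : 0 < s := hs
  have e : ∀ z, z i + δ s z =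
      (1 - ‖EuclideanSpace.single i (1 : ℝ) + s • z‖ ^ (-α)) / (α * s) := by
    intro z
    simp only [hδ]
    ring
  simp_rw [mul_one, e]
  congr 1
  have hI1 : IntegrableOn (fun z : EuclideanSpace ℝ (Fin N) =>
      oddPow p ((1 - ‖EuclideanSpace.single i (1 : ℝ) + s • z‖ ^ (-α)) / (α * s)))
      (ball 0 1) := by
    have hc : ContinuousOn (fun z : EuclideanSpace ℝ (Fin N) =>
        oddPow p ((1 - ‖EuclideanSpace.single i (1 : ℝ) + s • z‖ ^ (-α)) / (α * s)))
        (closedBall 0 1) := by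
      refine (continuous_oddPow hp).comp_continuousOn ?_
      refine ContinuousOn.div_const (continuousOn_const.sub ?_) _
      refine ContinuousOn.rpow_const (by fun_prop) fun z hz => Or.inl ?_
      rw [mem_closedBall_zero_iff] at hz
      rw [norm_ne_zero_iff]
      intro h0
      have h1 : ‖s • z‖ = 1 := by
        rw [eq_neg_of_add_eq_zero_right h0]
        simp
      rw [norm_smul, Real.norm_eq_abs, abs_of_pos hs'] at h1
      nlinarith [norm_nonneg z]
    exact (hc.integrableOn_compact (isCompact_closedBall 0 1)).mono_set ball_subset_closedBall
  have hI2 : IntegrableOn (fun z : EuclideanSpace ℝ (Fin N) => oddPow p (z i)) (ball 0 1) := by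
    have hc : Continuous fun z : EuclideanSpace ℝ (Fin N) => oddPow p (z i) :=
      (continuous_oddPow hp).comp (by fun_prop)
    exact (hc.continuousOn.integrableOn_compact (isCompact_closedBall 0 1)).mono_set
      ball_subset_closedBall
  rw [integral_sub hI1 hI2, integral_ball_oddPow_apply, sub_zero]

end UnitBall

section Balls

variable {N : ℕ}

lemma setIntegral_ball_eq_unitBall (x : EuclideanSpace ℝ (Fin N)) {r : ℝ} (hr : 0 < r)
    (f : EuclideanSpace ℝ (Fin N) → ℝ) :
    ∫ y in ball x r, f y = r ^ N * ∫ z in ball 0 1, f (x + r • z) := by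
  have h1 : ∫ z in ball 0 r, f (x + z) = ∫ y in ball x r, f y := by
    have h := (measurePreserving_add_left volume x).setIntegral_preimage_emb
      (measurableEmbedding_addLeft x) f (ball x r)
    rwa [preimage_add_ball, sub_self] at h
  have h2 := Measure.setIntegral_comp_smul_of_pos volume (fun z => f (x + z)) (ball 0 1) hr
  rw [smul_unitBall_of_pos hr, finrank_euclideanSpace_fin, h1] at h2
  rw [h2, smul_eq_mul, mul_inv_cancel_left₀ (pow_ne_zero _ hr.ne')]

lemma setIntegral_ball_oddPow_gamma {α p r : ℝ} (hα : 0 < α) (hr : 0 < r) (i : Fin N)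
    {x : EuclideanSpace ℝ (Fin N)} (hx : x ≠ 0) :
    ∃ κ > 0, ∫ y in ball x r, oddPow p (‖y‖ ^ (-α) - ‖x‖ ^ (-α)) =
      -(κ * ∫ z : EuclideanSpace ℝ (Fin N) in ball 0 1,
        oddPow p ((1 - ‖EuclideanSpace.single i (1 : ℝ) + (r / ‖x‖) • z‖ ^ (-α)) /
          (α * (r / ‖x‖)))) := by
  have hx0 : 0 < ‖x‖ := norm_pos_iff.2 hx
  set e := EuclideanSpace.single i (1 : ℝ) with he
  set s := r / ‖x‖ with hs
  have hs0 : 0 < s := by positivity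
  set w := ‖x‖⁻¹ • x with hw
  have hew : ‖e‖ = ‖w‖ := by
    rw [hw, norm_smul, norm_inv, norm_norm, inv_mul_cancel₀ hx0.ne', he]
    simp
  set U := (ℝ ∙ (e - w))ᗮ.reflection with hU
  have hUe : U e = w := Submodule.reflection_sub hew
  have hnorm : ∀ z, ‖x + r • U z‖ = ‖x‖ * ‖e + s • z‖ := by
    intro z
    have : x + r • U z = ‖x‖ • U (e + s • z) := by
      rw [map_add, map_smul, hUe, smul_add, hw, smul_smul, smul_smul, mul_inv_cancel₀ hx0.ne',
        one_smul, hs, mul_div_cancel₀ _ hx0.ne']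
    rw [this, norm_smul, norm_norm, LinearIsometryEquiv.norm_map]
  set c : ℝ := ‖x‖ ^ (-α) * (α * s) with hc
  have hc0 : 0 < c := by positivity
  refine ⟨r ^ N * c ^ (p - 1), by positivity, ?_⟩
  rw [setIntegral_ball_eq_unitBall x hr, ← setIntegral_ball_comp_linearIsometryEquiv U,
    mul_assoc, ← mul_neg]
  congr 1
  rw [← integral_const_mul, ← integral_neg]
  congr 1
  ext z
  rw [hnorm, Real.mul_rpow hx0.le (norm_nonneg _), ← oddPow_mul hc0, ← oddPow_neg, hc]
  congr 1
  field_simp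
  ring

lemma norm_pos_of_mem_ball {x y : EuclideanSpace ℝ (Fin N)} {r : ℝ} (hy : y ∈ ball x r) :
    ‖x‖ - r < ‖y‖ := by
  rw [mem_ball_iff_norm] at hy
  linarith [norm_sub_norm_le x y, norm_sub_rev x y]

lemma gamma_le_of_mem_ball {α : ℝ} (hα : 0 < α) {x y : EuclideanSpace ℝ (Fin N)} {r : ℝ}
    (hrx : r < ‖x‖) (hy : y ∈ ball x r) : ‖y‖ ^ (-α) ≤ (‖x‖ - r) ^ (-α) :=
  Real.rpow_le_rpow_of_nonpos (by linarith) (norm_pos_of_mem_ball hy).le (by linarith)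

lemma measurable_gamma (α : ℝ) : Measurable fun y : EuclideanSpace ℝ (Fin N) => ‖y‖ ^ (-α) := by
  fun_prop

lemma ae_abs_gamma_le {α : ℝ} (hα : 0 < α) {x : EuclideanSpace ℝ (Fin N)} {r : ℝ}
    (hrx : r < ‖x‖) :
    ∀ᵐ y ∂(volume.restrict (ball x r)), |‖y‖ ^ (-α)| ≤ (‖x‖ - r) ^ (-α) := by
  filter_upwards [ae_restrict_mem measurableSet_ball] with y hy
  rw [abs_of_nonneg (Real.rpow_nonneg (norm_nonneg _) _)]
  exact gamma_le_of_mem_ball hα hrx hy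

lemma isPMean_pMean_gamma {α : ℝ} (hα : 0 < α) {x : EuclideanSpace ℝ (Fin N)} {r : ℝ}
    (hr : 0 < r) (hrx : r < ‖x‖) {p : ℝ≥0∞} (hp : 1 ≤ p) :
    IsPMean p (volume.restrict (ball x r)) (fun y => ‖y‖ ^ (-α))
      (pMean p (volume.restrict (ball x r)) (fun y => ‖y‖ ^ (-α))) := by
  have : IsFiniteMeasure (volume.restrict (ball x r)) := ⟨by
    rw [Measure.restrict_apply_univ]; exact measure_ball_lt_top⟩
  refine isPMean_pMean ?_ (measurable_gamma α) (ae_abs_gamma_le hα hrx) hp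
  rw [Ne, Measure.restrict_eq_zero]
  exact (measure_ball_pos _ _ hr).ne'

lemma gamma_le_pMean_of_integral_pos {α : ℝ} (hα : 0 < α) {x : EuclideanSpace ℝ (Fin N)}
    {r : ℝ} (hr : 0 < r) (hrx : r < ‖x‖) {p : ℝ} (hp : 1 ≤ p)
    (h : 0 < ∫ y in ball x r, oddPow p (‖y‖ ^ (-α) - ‖x‖ ^ (-α))) :
    ‖x‖ ^ (-α) ≤
      pMean (ENNReal.ofReal p) (volume.restrict (ball x r)) (fun y => ‖y‖ ^ (-α)) := by
  have : IsFiniteMeasure (volume.restrict (ball x r)) := ⟨by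
    rw [Measure.restrict_apply_univ]; exact measure_ball_lt_top⟩
  exact (isPMean_pMean_gamma hα hr hrx (by simpa using hp)).le_of_integral_oddPow_pos
    (measurable_gamma α) (ae_abs_gamma_le hα hrx) hp h

lemma pMean_le_gamma_of_integral_neg {α : ℝ} (hα : 0 < α) {x : EuclideanSpace ℝ (Fin N)}
    {r : ℝ} (hr : 0 < r) (hrx : r < ‖x‖) {p : ℝ} (hp : 1 ≤ p)
    (h : ∫ y in ball x r, oddPow p (‖y‖ ^ (-α) - ‖x‖ ^ (-α)) < 0) :
    pMean (ENNReal.ofReal p) (volume.restrict (ball x r)) (fun y => ‖y‖ ^ (-α)) ≤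
      ‖x‖ ^ (-α) := by
  have : IsFiniteMeasure (volume.restrict (ball x r)) := ⟨by
    rw [Measure.restrict_apply_univ]; exact measure_ball_lt_top⟩
  exact (isPMean_pMean_gamma hα hr hrx (by simpa using hp)).le_of_integral_oddPow_neg
    (measurable_gamma α) (ae_abs_gamma_le hα hrx) hp h

lemma gamma_le_pMean_top {α : ℝ} (hα : 0 < α) {x : EuclideanSpace ℝ (Fin N)}
    {r : ℝ} (hr : 0 < r) (hrx : r < ‖x‖) :
    ‖x‖ ^ (-α) ≤ pMean ∞ (volume.restrict (ball x r)) (fun y => ‖y‖ ^ (-α)) := by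
  have hx0 : 0 < ‖x‖ := hr.trans hrx
  have hcM : ‖x‖ ^ (-α) ≤ (‖x‖ - r) ^ (-α) :=
    Real.rpow_le_rpow_of_nonpos (by linarith) (by linarith) (by linarith)
  refine (isPMean_pMean_gamma hα hr hrx le_top).le_of_top hcM ?_ fun t ht => ?_
  · filter_upwards [ae_restrict_mem measurableSet_ball] with y hy
    have h1 := gamma_le_of_mem_ball hα hrx hy
    have hy0 : 0 < ‖y‖ := by linarith [norm_pos_of_mem_ball hy]
    have h2 : (‖x‖ + r) ^ (-α) ≤ ‖y‖ ^ (-α) := by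
      refine Real.rpow_le_rpow_of_nonpos hy0 ?_ (by linarith)
      rw [mem_ball_iff_norm] at hy
      linarith [norm_sub_norm_le y x]
    have h3 := rpow_neg_le_half_add hα hr.le hrx
    rw [abs_le]
    constructor <;> linarith
  · have hcont : ContinuousAt (fun u : ℝ => (‖x‖ - u) ^ (-α)) r :=
      ContinuousAt.rpow_const (by fun_prop) (Or.inl (by linarith))
    have hev : ∀ᶠ u in 𝓝[<] r, t < (‖x‖ - u) ^ (-α) :=
      (hcont.tendsto.eventually (lt_mem_nhds ht)).filter_mono nhdsWithin_le_nhds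
    obtain ⟨u, hu, hur⟩ := (hev.and (Ioo_mem_nhdsLT hr)).exists
    have hopen : IsOpen (ball x r ∩ (fun y => ‖y‖ ^ (-α)) ⁻¹' Set.Ioi t) := by
      refine ContinuousOn.isOpen_inter_preimage ?_ isOpen_ball isOpen_Ioi
      refine ContinuousOn.rpow_const (by fun_prop) fun y hy => Or.inl ?_
      have := norm_pos_of_mem_ball hy
      linarith
    have hne : (ball x r ∩ (fun y => ‖y‖ ^ (-α)) ⁻¹' Set.Ioi t).Nonempty := by
      have hn : ‖(1 - u / ‖x‖) • x‖ = ‖x‖ - u := by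
        rw [norm_smul, Real.norm_eq_abs, abs_of_pos]
        · field_simp
        · rw [sub_pos, div_lt_one hx0]; linarith [hur.2]
      refine ⟨(1 - u / ‖x‖) • x, ?_, ?_⟩
      · rw [mem_ball_iff_norm]
        have : (1 - u / ‖x‖) • x - x = -((u / ‖x‖) • x) := by rw [sub_smul, one_smul]; abel
        rw [this, norm_neg, norm_smul, norm_div, norm_norm, Real.norm_eq_abs,
          abs_of_pos hur.1, div_mul_cancel₀ _ hx0.ne']
        exact hur.2
      · simp only [Set.mem_preimage, Set.mem_Ioi, hn]
        exact hu
    rw [frequently_ae_iff]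
    have hpos := hopen.measure_pos volume hne
    refine (hpos.trans_le ?_).ne'
    rw [Set.inter_comm]
    exact Measure.le_restrict_apply _ _

lemma oddPow_one_of_pos {t : ℝ} (ht : 0 < t) : oddPow 1 t = 1 := by
  rw [oddPow, abs_of_pos ht, ← Real.rpow_add_one ht.ne']
  norm_num

lemma oddPow_one_of_neg {t : ℝ} (ht : t < 0) : oddPow 1 t = -1 := by
  rw [← neg_neg t, oddPow_neg, oddPow_one_of_pos (neg_pos.2 ht)]

lemma oddPow_one_gamma_sub_of_lt {α a b : ℝ} (hα : 0 < α) (ha : 0 < a) (hab : a < b) :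
    oddPow 1 (b ^ (-α) - a ^ (-α)) = -1 :=
  oddPow_one_of_neg (sub_neg.2 (Real.rpow_lt_rpow_of_neg ha hab (by linarith)))

lemma exists_orthogonal_ne_zero (hN : 1 < N) {x : EuclideanSpace ℝ (Fin N)} (hx : x ≠ 0) :
    ∃ w : EuclideanSpace ℝ (Fin N), w ≠ 0 ∧ inner ℝ x w = 0 := by
  by_contra! h
  have hbot : (ℝ ∙ x)ᗮ = ⊥ := by
    rw [Submodule.eq_bot_iff]
    intro w hw
    by_contra hne
    exact h w hne (Submodule.mem_orthogonal_singleton_iff_inner_right.1 hw)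
  have h1 := Submodule.finrank_add_finrank_orthogonal (ℝ ∙ x)
  rw [hbot, finrank_bot, finrank_euclideanSpace_fin] at h1
  have h2 := finrank_span_singleton (K := ℝ) hx
  omega

lemma setIntegral_ball_oddPow_one_gamma_neg {α : ℝ} (hα : 0 < α) (hN : 1 < N)
    {x : EuclideanSpace ℝ (Fin N)} {r : ℝ} (hr : 0 < r) (hrx : r < ‖x‖) :
    ∫ y in ball x r, oddPow 1 (‖y‖ ^ (-α) - ‖x‖ ^ (-α)) < 0 := by
  have hx0 : 0 < ‖x‖ := hr.trans hrx
  rw [setIntegral_ball_eq_unitBall x hr]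
  refine mul_neg_of_pos_of_neg (by positivity) ?_
  set F : EuclideanSpace ℝ (Fin N) → ℝ :=
    fun z => oddPow 1 (‖x + r • z‖ ^ (-α) - ‖x‖ ^ (-α)) with hF
  have hFle : ∀ z, |F z| ≤ 1 := fun z => by
    simpa using abs_oddPow_le (p := 1) le_rfl
      (le_refl |‖x + r • z‖ ^ (-α) - ‖x‖ ^ (-α)|)
  have hFm : Measurable F := (measurable_oddPow 1).comp (by fun_prop)
  have hFlt : ∀ z, ‖x‖ < ‖x + r • z‖ → F z = -1 := fun z hz =>
    oddPow_one_gamma_sub_of_lt hα hx0 hz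
  have hFi : IntegrableOn F (ball 0 1) :=
    Integrable.mono' (integrableOn_const (C := (1 : ℝ)) measure_ball_lt_top.ne)
      hFm.aestronglyMeasurable (Eventually.of_forall hFle)
  have hFi' : IntegrableOn (fun z => F (-z)) (ball 0 1) :=
    Integrable.mono' (integrableOn_const (C := (1 : ℝ)) measure_ball_lt_top.ne)
      (hFm.comp measurable_neg).aestronglyMeasurable (Eventually.of_forall fun z => hFle (-z))
  have hneg : ∫ z in ball 0 1, F (-z) = ∫ z in ball 0 1, F z := by
    simpa using setIntegral_ball_comp_linearIsometryEquiv (LinearIsometryEquiv.neg ℝ) F 1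
  have hpar : ∀ z, ‖x + r • z‖ ^ 2 + ‖x + r • -z‖ ^ 2 = 2 * ‖x‖ ^ 2 + 2 * ‖r • z‖ ^ 2 := by
    intro z
    have := parallelogram_law_with_norm ℝ x (r • z)
    rw [smul_neg, ← sub_eq_add_neg]
    nlinarith
  have hnonneg : ∀ z, 0 ≤ -(F z + F (-z)) := by
    intro z
    have h1 := abs_le.1 (hFle z)
    have h2 := abs_le.1 (hFle (-z))
    have h3 := hpar z
    rcases lt_trichotomy ‖x‖ ‖x + r • z‖ with h | h | h
    · rw [hFlt z h]; linarith
    · have h4 : F z = 0 := by simp only [hF, ← h, sub_self, oddPow_zero]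
      rcases lt_or_ge ‖x‖ ‖x + r • -z‖ with h5 | h5
      · rw [h4, hFlt _ h5]; norm_num
      · have h6 : ‖x + r • -z‖ = ‖x‖ := by
          refine le_antisymm h5 (le_of_sq_le_sq ?_ (norm_nonneg _))
          rw [← h] at h3
          nlinarith [sq_nonneg ‖r • z‖]
        have h7 : F (-z) = 0 := by simp only [hF, h6, sub_self, oddPow_zero]
        rw [h4, h7]; norm_num
    · have h5 : ‖x‖ < ‖x + r • -z‖ := by
        refine lt_of_pow_lt_pow_left₀ 2 (norm_nonneg _) ?_
        have := pow_lt_pow_left₀ h (norm_nonneg _) two_ne_zero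
        nlinarith [sq_nonneg ‖r • z‖]
      rw [hFlt _ h5]; linarith
  have hpos : 0 < ∫ z in ball 0 1, -(F z + F (-z)) := by
    rw [integral_pos_iff_support_of_nonneg_ae (Eventually.of_forall hnonneg)
      (hFi.add hFi').neg]
    have hopen : IsOpen (ball (0 : EuclideanSpace ℝ (Fin N)) 1 ∩
        ({z | ‖x‖ < ‖x + r • z‖} ∩ {z | ‖x‖ < ‖x + r • -z‖})) :=
      isOpen_ball.inter ((isOpen_lt (by fun_prop) (by fun_prop)).inter
        (isOpen_lt (by fun_prop) (by fun_prop)))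
    have hne : (ball (0 : EuclideanSpace ℝ (Fin N)) 1 ∩
        ({z | ‖x‖ < ‖x + r • z‖} ∩ {z | ‖x‖ < ‖x + r • -z‖})).Nonempty := by
      obtain ⟨w, hw0, hw⟩ := exists_orthogonal_ne_zero hN (norm_pos_iff.1 hx0)
      have hw0' : 0 < ‖w‖ := norm_pos_iff.2 hw0
      have key : ∀ c : ℝ, c ≠ 0 → ‖x‖ < ‖x + r • c • w‖ := by
        intro c hc
        refine lt_of_pow_lt_pow_left₀ 2 (norm_nonneg _) ?_
        rw [norm_add_sq_real, inner_smul_right, inner_smul_right, hw]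
        have : 0 < ‖r • c • w‖ := norm_pos_iff.2 (by simp [hr.ne', hc, hw0])
        nlinarith [pow_pos this 2]
      refine ⟨(‖w‖⁻¹ / 2) • w, ?_, key _ (by positivity), ?_⟩
      · rw [mem_ball_zero_iff, norm_smul, norm_div, norm_inv, norm_norm]
        field_simp
        norm_num
      · have := key (-(‖w‖⁻¹ / 2)) (neg_ne_zero.2 (by positivity))
        rwa [neg_smul] at this
    have hm := hopen.measure_pos volume hne
    rw [Set.inter_comm] at hm
    refine (hm.trans_le (Measure.le_restrict_apply _ _)).trans_le (measure_mono fun z hz => ?_)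
    have h1 := hFlt z hz.1
    have h2 := hFlt (-z) hz.2
    rw [Function.mem_support, h1, h2]
    norm_num
  rw [integral_neg, integral_add hFi hFi', hneg] at hpos
  linarith

end Balls

/-- Example 3.1 (iii): the function `γ_α(y) = |y|^{-α}`, `α > 0`, is
variationally `p`-subharmonious on a bounded open set `Ω` with `0 ∉ closure Ω` for
`p > (α+N)/(α+1)`, and variationally `p`-superharmonious for `p < (α+N)/(α+1)`,
for all sufficiently small radii `r`. -/
theorem gammaAlpha_subSuperHarmonious {N : ℕ} (α : ℝ) (hα : 0 < α)
    (p : ℝ≥0∞) (hp : 1 ≤ p)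
    (Ω : Set (EuclideanSpace ℝ (Fin N))) (hΩo : IsOpen Ω) (hΩb : Bornology.IsBounded Ω)
    (h0 : (0 : EuclideanSpace ℝ (Fin N)) ∉ closure Ω) :
    ∃ rΩ > (0 : ℝ), ∀ r : ℝ, 0 < r → r < rΩ →
      (ENNReal.ofReal ((α + N) / (α + 1)) < p →
        ∀ x ∈ closure Ω,
          ‖x‖ ^ (-α) ≤
            pMean p (volume.restrict (Metric.ball x r)) (fun y => ‖y‖ ^ (-α))) ∧
      (p < ENNReal.ofReal ((α + N) / (α + 1)) →
        ∀ x ∈ closure Ω,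
          pMean p (volume.restrict (Metric.ball x r)) (fun y => ‖y‖ ^ (-α)) ≤
            ‖x‖ ^ (-α)) := by
  obtain ⟨d, hd0, hd⟩ : ∃ d > 0, ∀ x ∈ closure Ω, d ≤ ‖x‖ := by
    obtain ⟨d, hd0, hd⟩ := Metric.isOpen_iff.1 isClosed_closure.isOpen_compl 0 h0
    refine ⟨d, hd0, fun x hx => ?_⟩
    by_contra! hlt
    exact hd (mem_ball_zero_iff.2 hlt) hx
  rcases isEmpty_or_nonempty (Fin N) with hN | ⟨⟨i⟩⟩
  · refine ⟨1, one_pos, fun r _ _ => ⟨fun _ x hx => ?_, fun _ x hx => ?_⟩⟩ <;>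
    exact absurd (Subsingleton.elim x 0 ▸ hx) h0
  have hN : 1 ≤ N := Nat.one_le_of_lt i.2
  have hα1 : 0 < α + 1 := by linarith
  rcases eq_or_ne p ∞ with rfl | hptop
  · exact ⟨d, hd0, fun r hr hrd => ⟨fun _ x hx => gamma_le_pMean_top hα hr
      (hrd.trans_le (hd x hx)), fun h => absurd h (by simp)⟩⟩
  obtain ⟨q, hq, rfl⟩ : ∃ q : ℝ, 1 ≤ q ∧ p = ENNReal.ofReal q :=
    ⟨p.toReal, by simpa using ENNReal.toReal_mono hptop hp, (ENNReal.ofReal_toReal hptop).symm⟩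
  have hlt : ENNReal.ofReal ((α + N) / (α + 1)) < ENNReal.ofReal q ↔ α + N < (α + 1) * q := by
    rw [ENNReal.ofReal_lt_ofReal_iff (by linarith), div_lt_iff₀ hα1, mul_comm]
  have hgt : ENNReal.ofReal q < ENNReal.ofReal ((α + N) / (α + 1)) ↔ (α + 1) * q < α + N := by
    rw [ENNReal.ofReal_lt_ofReal_iff (by positivity), lt_div_iff₀ hα1, mul_comm]
  rw [hlt, hgt]
  rcases hq.eq_or_lt with rfl | hq1
  · refine ⟨d, hd0, fun r hr hrd => ⟨fun h => ?_, fun h x hx => ?_⟩⟩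
    · have : (1 : ℝ) ≤ N := by exact_mod_cast hN
      linarith
    · have h1 : (1 : ℝ) < N := by linarith
      have hrx := hrd.trans_le (hd x hx)
      exact pMean_le_gamma_of_integral_neg hα hr hrx le_rfl
        (setIntegral_ball_oddPow_one_gamma_neg hα (by exact_mod_cast h1) hr hrx)
  have hlim := tendsto_integral_ball_oddPow_gamma hα hq1 i
  have hW := integral_ball_abs_apply_rpow_pos (p := q) (by linarith) i
  have hev : ∀ᶠ s in 𝓝[>] (0 : ℝ),
      (α + N < (α + 1) * q → ∫ z : EuclideanSpace ℝ (Fin N) in ball 0 1, oddPow q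
        ((1 - ‖EuclideanSpace.single i (1 : ℝ) + s • z‖ ^ (-α)) / (α * s)) < 0) ∧
      ((α + 1) * q < α + N → 0 < ∫ z : EuclideanSpace ℝ (Fin N) in ball 0 1, oddPow q
        ((1 - ‖EuclideanSpace.single i (1 : ℝ) + s • z‖ ^ (-α)) / (α * s))) := by
    refine Filter.Eventually.and ?_ ?_
    · rw [eventually_imp_distrib_left]
      intro h
      filter_upwards [self_mem_nhdsWithin,
        hlim.eventually (gt_mem_nhds (mul_neg_of_neg_of_pos (by linarith) hW))] with s hs h1
      exact neg_of_mul_neg_right h1 (inv_pos.2 hs).le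
    · rw [eventually_imp_distrib_left]
      intro h
      filter_upwards [self_mem_nhdsWithin,
        hlim.eventually (lt_mem_nhds (mul_pos (by linarith) hW))] with s hs h1
      exact pos_of_mul_pos_right h1 (inv_pos.2 hs).le
  obtain ⟨s₀, hs₀, hs⟩ := mem_nhdsGT_iff_exists_Ioo_subset.1 hev
  have hs₀' : 0 < s₀ := hs₀
  refine ⟨min d (d * s₀), by positivity, fun r hr hrd => ?_⟩
  have hmem : ∀ x ∈ closure Ω, r < ‖x‖ ∧ r / ‖x‖ ∈ Set.Ioo 0 s₀ := by
    intro x hx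
    have hdx := hd x hx
    have hx0 : 0 < ‖x‖ := hd0.trans_le hdx
    refine ⟨(hrd.trans_le (min_le_left _ _)).trans_le hdx, by positivity, ?_⟩
    rw [div_lt_iff₀ hx0]
    calc r < d * s₀ := hrd.trans_le (min_le_right _ _)
      _ ≤ ‖x‖ * s₀ := by gcongr
      _ = s₀ * ‖x‖ := mul_comm _ _
  refine ⟨fun h x hx => ?_, fun h x hx => ?_⟩
  all_goals
    obtain ⟨hrx, hsx⟩ := hmem x hx
    obtain ⟨κ, hκ, hint⟩ :=
      setIntegral_ball_oddPow_gamma (p := q) hα hr i (norm_pos_iff.1 (hr.trans hrx))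
  · refine gamma_le_pMean_of_integral_pos hα hr hrx hq ?_
    rw [hint, neg_pos]
    exact mul_neg_of_pos_of_neg hκ ((hs hsx).1 h)
  · refine pMean_le_gamma_of_integral_neg hα hr hrx hq ?_
    rw [hint, neg_lt_zero]
    exact mul_pos hκ ((hs hsx).2 h)
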